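/- Let n ≥ 1, c ∈ ℝ, and H : ℝⁿ × ℝⁿ → ℝ smooth. Define the conformal Hamiltonian vector field X_c(q,p) = (∂H/∂pᵢ, c·pᵢ − ∂H/∂qⁱ)(q,p), determined by ι_{X_c}Ω_Q = dH − cΘ_Q with Ω_Q = dqⁱ ∧ dpᵢ and Θ_Q = pᵢ dqⁱ. Let γ : ℝⁿ → ℝⁿ be a closed one-form (∂γᵢ/∂qʲ = ∂γⱼ/∂qⁱ for all i, j), and let X_c^γ(q) have components (∂H/∂pᵢ)(q, γ(q)). Then the following are equivalent: (i) X_c^γ and X_c are γ-related, i.e. Σᵢ (∂γⱼ/∂qⁱ)(q)·(∂H/∂pᵢ)(q,γ(q)) = c·γⱼ(q) − (∂H/∂qʲ)(q,γ(q)) for all j, q; (ii) d(H ∘ γ) = c·γ*Θ_Q, i.e. ∂/∂qʲ [H(q, γ(q))] = c·γⱼ(q) for all j, q. (For c = 0 this recovers the classical symplectic Hamilton–Jacobi theorem.) -/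

import Mathlib

/-- Coordinate form of the chain rule for a function restricted to the graph of `γ`. -/
theorem fderiv_comp_graph_apply {E ι : Type*} [NormedAddCommGroup E] [NormedSpace ℝ E]
    [Fintype ι] [DecidableEq ι] {H : E × (ι → ℝ) → ℝ} {γ : E → ι → ℝ} {q : E}
    (hH : DifferentiableAt ℝ H (q, γ q)) (hγ : DifferentiableAt ℝ γ q) (v : E) :
    fderiv ℝ (fun q' => H (q', γ q')) q v =
      fderiv ℝ H (q, γ q) (v, 0) +
        ∑ i, fderiv ℝ (fun q' => γ q' i) q v * fderiv ℝ H (q, γ q) (0, Pi.single i 1) := by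
  have hcomp : HasFDerivAt (fun q' => H (q', γ q'))
      ((fderiv ℝ H (q, γ q)).comp ((ContinuousLinearMap.id ℝ E).prod (fderiv ℝ γ q))) q :=
    hH.hasFDerivAt.comp q ((hasFDerivAt_id q).prodMk hγ.hasFDerivAt)
  have hcoord (i : ι) : fderiv ℝ (fun q' => γ q' i) q v = fderiv ℝ γ q v i := by
    rw [(hasFDerivAt_pi'.1 hγ.hasFDerivAt i).fderiv]
    rfl
  have hsplit : (v, fderiv ℝ γ q v) =
      (v, 0) + ∑ i, fderiv ℝ γ q v i • ((0 : E), (Pi.single i 1 : ι → ℝ)) := by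
    ext i
    · simp [Prod.fst_sum]
    · simp [Prod.snd_sum, Finset.sum_apply, Pi.single_apply]
  simp only [hcomp.fderiv, hcoord, ContinuousLinearMap.comp_apply,
    ContinuousLinearMap.prod_apply, ContinuousLinearMap.id_apply]
  rw [hsplit, map_add, map_sum]
  simp only [map_smul, smul_eq_mul]


/-- **Hamilton–Jacobi theorem for conformal Hamiltonian systems.**
For the conformal Hamiltonian vector field `X_c = (∂H/∂pᵢ, c pᵢ − ∂H/∂qⁱ)` with
conformal factor `c`, and a closed one-form `γ`, the projected field `X_c^γ` and
`X_c` are `γ`-related iff `d(H ∘ γ) = c · γ*Θ_Q`, i.e.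
`∂/∂qʲ [H(q, γ(q))] = c·γⱼ(q)` for all `j, q`. -/
theorem stmt_5 (n : ℕ) (hn : 1 ≤ n) (c : ℝ)
    (H : (Fin n → ℝ) × (Fin n → ℝ) → ℝ) (hH : ContDiff ℝ (⊤ : ℕ∞) H)
    (γ : (Fin n → ℝ) → (Fin n → ℝ)) (hγ : ContDiff ℝ (⊤ : ℕ∞) γ)
    (hclosed : ∀ (i j : Fin n) (q : Fin n → ℝ),
      fderiv ℝ (fun q' => γ q' i) q (Pi.single j 1) =
        fderiv ℝ (fun q' => γ q' j) q (Pi.single i 1)) :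
    (∀ (j : Fin n) (q : Fin n → ℝ),
        ∑ i, fderiv ℝ (fun q' => γ q' j) q (Pi.single i 1) *
            fderiv ℝ H (q, γ q) ((0 : Fin n → ℝ), Pi.single i 1) =
          c * γ q j - fderiv ℝ H (q, γ q) (Pi.single j 1, (0 : Fin n → ℝ))) ↔
    (∀ (j : Fin n) (q : Fin n → ℝ),
        fderiv ℝ (fun q' => H (q', γ q')) q (Pi.single j 1) = c * γ q j) := by
  refine forall_congr' fun j => forall_congr' fun q => ?_
  rw [fderiv_comp_graph_apply (hH.differentiable (by simp) _) (hγ.differentiable (by simp) q)]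
  simp only [hclosed _ j q]
  rw [eq_sub_iff_add_eq']
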